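/- arXiv:0909.4933 — 8 statements merged into one kernel-verified Lean document; each statement's English description precedes it below -/
import Mathlib

section
/- Let (w_0,w_1) and (w_0',w_1') be two positive weight functions on the edges of the lattice ℤ₊². The following are equivalent: (i) there exists a positive function f : ℕ×ℕ → ℝ such that w_1'(h,t) = w_1(h,t)·f(h,t)/f(h+1,t) and w_0'(h,t) = w_0(h,t)·f(h,t)/f(h,t+1) for all (h,t); (ii) for every (h,t) ∈ ℕ×ℕ and any two standard paths γ, γ' from (0,0) to (h,t), the ratio of the w'-weight to the w-weight of γ equals the ratio of the w'-weight to the w-weight of γ' (i.e., the normalized path-weight distribution on standard paths to each point is the same for the two weightings, so they determine the same class of lookback similar processes). -/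
open Finset

/-- Number of head steps (`true` increments) among the first `m` steps of the path `γ`. -/
def headsUpTo {n : ℕ} (γ : Fin n → Bool) (m : ℕ) : ℕ :=
  ((Finset.univ : Finset (Fin n)).filter (fun i => i.val < m ∧ γ i = true)).card

/-- The weight of a standard path: the product over steps of the weight of the traversed edge,
where the position before step `i` is `(h_i, i - h_i)` with `h_i` the number of heads so far. -/
def pathWeight (w0 w1 : ℕ × ℕ → ℝ) {n : ℕ} (γ : Fin n → Bool) : ℝ :=
  ∏ i : Fin n,
    (if γ i then w1 (headsUpTo γ i.val, i.val - headsUpTo γ i.val)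
     else w0 (headsUpTo γ i.val, i.val - headsUpTo γ i.val))

lemma headsUpTo_eq_sum {n : ℕ} (γ : Fin n → Bool) (m : ℕ) :
    headsUpTo γ m = ∑ i : Fin n, if i.val < m ∧ γ i = true then 1 else 0 := by
  rw [headsUpTo, Finset.card_filter]

lemma headsUpTo_le {n : ℕ} (γ : Fin n → Bool) (m : ℕ) : headsUpTo γ m ≤ n := by
  simpa [headsUpTo] using Finset.card_filter_le (Finset.univ : Finset (Fin n))
    (fun i => i.val < m ∧ γ i = true)

lemma headsUpTo_snoc_of_le {n : ℕ} (γ : Fin n → Bool) (b : Bool) {m : ℕ} (hm : m ≤ n) :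
    headsUpTo (Fin.snoc γ b : Fin (n + 1) → Bool) m = headsUpTo γ m := by
  simp only [headsUpTo_eq_sum, Fin.sum_univ_castSucc, Fin.snoc_castSucc, Fin.val_castSucc,
    Fin.val_last, hm.not_gt, false_and, if_false, add_zero]

lemma headsUpTo_snoc_succ {n : ℕ} (γ : Fin n → Bool) (b : Bool) :
    headsUpTo (Fin.snoc γ b : Fin (n + 1) → Bool) (n + 1) =
      headsUpTo γ n + if b then 1 else 0 := by
  simp only [headsUpTo_eq_sum, Fin.sum_univ_castSucc, Fin.snoc_castSucc, Fin.snoc_last]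
  congr 1
  · refine Finset.sum_congr rfl fun i _ => ?_
    have := i.isLt
    simp [this.trans (Nat.lt_succ_self n)]
  · simp

lemma headsUpTo_heads_first {n h : ℕ} (hn : h ≤ n) :
    headsUpTo (fun i : Fin n => decide (i.val < h)) n = h := by
  simp [headsUpTo, Fin.card_filter_val_lt, hn]

lemma pathWeight_snoc (w0 w1 : ℕ × ℕ → ℝ) {n : ℕ} (γ : Fin n → Bool) (b : Bool) :
    pathWeight w0 w1 (Fin.snoc γ b : Fin (n + 1) → Bool) =
      pathWeight w0 w1 γ *
        if b then w1 (headsUpTo γ n, n - headsUpTo γ n)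
        else w0 (headsUpTo γ n, n - headsUpTo γ n) := by
  simp only [pathWeight, Fin.prod_univ_castSucc, Fin.snoc_castSucc, Fin.snoc_last, Fin.val_last,
    Fin.val_castSucc, headsUpTo_snoc_of_le γ b le_rfl]
  congr 1
  refine Finset.prod_congr rfl fun i _ => ?_
  rw [headsUpTo_snoc_of_le γ b i.isLt.le]

lemma pathWeight_pos {w0 w1 : ℕ × ℕ → ℝ} (hw0 : ∀ p, 0 < w0 p) (hw1 : ∀ p, 0 < w1 p)
    {n : ℕ} (γ : Fin n → Bool) : 0 < pathWeight w0 w1 γ := by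
  refine Finset.prod_pos fun i _ => ?_
  split_ifs
  exacts [hw1 _, hw0 _]

/-- Under the transformation by `f`, path weights change by a factor depending only on the
endpoint. -/
lemma pathWeight_transform {w0 w1 w0' w1' f : ℕ × ℕ → ℝ} (hf : ∀ p, 0 < f p)
    (h1 : ∀ h t, w1' (h, t) = w1 (h, t) * f (h, t) / f (h + 1, t))
    (h0 : ∀ h t, w0' (h, t) = w0 (h, t) * f (h, t) / f (h, t + 1))
    {n : ℕ} (γ : Fin n → Bool) :
    pathWeight w0' w1' γ =
      pathWeight w0 w1 γ * (f (0, 0) / f (headsUpTo γ n, n - headsUpTo γ n)) := by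
  induction n with
  | zero => simp [pathWeight, headsUpTo, (hf (0, 0)).ne']
  | succ n ih =>
    rw [← Fin.snoc_init_self γ, pathWeight_snoc, pathWeight_snoc, headsUpTo_snoc_succ,
      ih (Fin.init γ)]
    have hle := headsUpTo_le (Fin.init γ) n
    generalize headsUpTo (Fin.init γ) n = h at hle ⊢
    have hne := fun p => (hf p).ne'
    have ha := hne (h, n - h)
    cases γ (Fin.last n)
    · have hb := hne (h, n - h + 1)
      simp only [Bool.false_eq_true, if_false, add_zero, Nat.succ_sub hle, Nat.succ_eq_add_one, h0]
      field_simp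
    · have hb := hne (h + 1, n - h)
      simp only [if_true, Nat.add_sub_add_right, h1]
      field_simp

theorem weight_transformation_iff_same_conditional_distributions
    (w0 w1 w0' w1' : ℕ × ℕ → ℝ)
    (hw0 : ∀ p, 0 < w0 p) (hw1 : ∀ p, 0 < w1 p)
    (hw0' : ∀ p, 0 < w0' p) (hw1' : ∀ p, 0 < w1' p) :
    (∃ f : ℕ × ℕ → ℝ, (∀ p, 0 < f p) ∧
        (∀ h t, w1' (h, t) = w1 (h, t) * f (h, t) / f (h + 1, t)) ∧
        (∀ h t, w0' (h, t) = w0 (h, t) * f (h, t) / f (h, t + 1)))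
      ↔ (∀ (n : ℕ) (γ γ' : Fin n → Bool), headsUpTo γ n = headsUpTo γ' n →
          pathWeight w0' w1' γ / pathWeight w0 w1 γ
            = pathWeight w0' w1' γ' / pathWeight w0 w1 γ') := by
  constructor
  · rintro ⟨f, hf, h1, h0⟩ n γ γ' hγ
    rw [pathWeight_transform hf h1 h0 γ, pathWeight_transform hf h1 h0 γ', hγ,
      mul_div_cancel_left₀ _ (pathWeight_pos hw0 hw1 γ).ne',
      mul_div_cancel_left₀ _ (pathWeight_pos hw0 hw1 γ').ne']
  · intro H
    let c (h t : ℕ) : Fin (h + t) → Bool := fun i => decide (i.val < h)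
    have hc (h t : ℕ) : headsUpTo (c h t) (h + t) = h := headsUpTo_heads_first (h.le_add_right t)
    have hpos {n : ℕ} (γ : Fin n → Bool) : 0 < pathWeight w0 w1 γ := pathWeight_pos hw0 hw1 γ
    have hpos' {n : ℕ} (γ : Fin n → Bool) : 0 < pathWeight w0' w1' γ := pathWeight_pos hw0' hw1' γ
    let f : ℕ × ℕ → ℝ := fun p => pathWeight w0 w1 (c p.1 p.2) / pathWeight w0' w1' (c p.1 p.2)
    have hf {h t n : ℕ} (γ : Fin n → Bool) (hn : n = h + t) (hγ : headsUpTo γ n = h) :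
        f (h, t) = pathWeight w0 w1 γ / pathWeight w0' w1' γ := by
      subst hn
      simpa only [inv_div] using congrArg Inv.inv (H _ (c h t) γ ((hc h t).trans hγ.symm))
    refine ⟨f, fun p => div_pos (hpos _) (hpos' _), fun h t => ?_, fun h t => ?_⟩
    · rw [hf (c h t) rfl (hc h t), hf (Fin.snoc (c h t) true : Fin (h + t + 1) → Bool)
        (by omega) (by simp [headsUpTo_snoc_succ, hc]), pathWeight_snoc, pathWeight_snoc, hc]
      simp only [if_true, Nat.add_sub_cancel_left]
      have := (hpos (c h t)).ne'
      have := (hpos' (c h t)).ne'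
      have := (hw1 (h, t)).ne'
      have := (hw1' (h, t)).ne'
      field_simp
    · rw [hf (c h t) rfl (hc h t), hf (Fin.snoc (c h t) false : Fin (h + t + 1) → Bool)
        (by omega) (by simp [headsUpTo_snoc_succ, hc]), pathWeight_snoc, pathWeight_snoc, hc]
      simp only [Bool.false_eq_true, if_false, Nat.add_sub_cancel_left]
      have := (hpos (c h t)).ne'
      have := (hpos' (c h t)).ne'
      have := (hw0 (h, t)).ne'
      have := (hw0' (h, t)).ne'
      field_simp
end

section
/- Let (a_n)_{n≥0} and (b_h)_{h≥0} be real sequences, and define the generalized Stirling numbers d(h,t) by d(0,0) = 1 and d(h,t) = d(h−1,t) + (a_{h+t−1} + b_h)·d(h,t−1), where terms with a negative index are omitted. Then for every real θ and every n ≥ 0, ∏_{j=0}^{n−1}(θ + a_j) = Σ_{h=0}^{n} d(h,n−h)·∏_{j=0}^{h−1}(θ − b_j); that is, the generalized Stirling numbers are the transition coefficients between the polynomial bases A_n(θ) = ∏_{j=0}^{n−1}(θ+a_j) and B_h(θ) = ∏_{j=0}^{h−1}(θ−b_j). -/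
open Finset

/-- A partial sum of the recursion along the `(n+1)`-st antidiagonal, tested against weights `B`. -/
lemma sum_range_stirling_antidiagonal_succ
    (a b B : ℕ → ℝ) (d : ℕ → ℕ → ℝ)
    (hd0t : ∀ t, d 0 (t + 1) = (a t + b 0) * d 0 t)
    (hdrec : ∀ h t, d (h + 1) (t + 1)
      = d h (t + 1) + (a (h + t + 1) + b (h + 1)) * d (h + 1) t)
    (n m : ℕ) (hm : m ≤ n) :
    ∑ h ∈ Finset.range (m + 1), d h (n + 1 - h) * B h
      = ∑ h ∈ Finset.range (m + 1), (a n + b h) * d h (n - h) * B h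
        + ∑ h ∈ Finset.range m, d h (n - h) * B (h + 1) := by
  induction m with
  | zero => simp [hd0t]
  | succ m ih =>
    obtain ⟨t, rfl⟩ := Nat.exists_eq_add_of_le hm
    rw [Finset.sum_range_succ, ih (by omega), Finset.sum_range_succ _ (m + 1),
      Finset.sum_range_succ (fun h => d h (m + 1 + t - h) * B (h + 1)) m,
      show m + 1 + t + 1 - (m + 1) = t + 1 by omega,
      show m + 1 + t - (m + 1) = t by omega, show m + 1 + t - m = t + 1 by omega, hdrec,
      show m + t + 1 = m + 1 + t by omega]
    ring

/-- The generalized Stirling numbers `d(h,t)` (dimensions of the generalized Stirling triangle,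
with the recursion `d(h,t) = d(h-1,t) + (a_{h+t-1} + b_h) d(h,t-1)`, negative-index terms omitted)
are the transition coefficients between the polynomial bases
`A_n(θ) = ∏_{j<n}(θ + a_j)` and `B_h(θ) = ∏_{j<h}(θ - b_j)`. -/
theorem generalized_stirling_transition_coefficients
    (a b : ℕ → ℝ) (d : ℕ → ℕ → ℝ)
    (hd00 : d 0 0 = 1)
    (hdh0 : ∀ h, d (h + 1) 0 = d h 0)
    (hd0t : ∀ t, d 0 (t + 1) = (a t + b 0) * d 0 t)
    (hdrec : ∀ h t, d (h + 1) (t + 1)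
      = d h (t + 1) + (a (h + t + 1) + b (h + 1)) * d (h + 1) t) :
    ∀ (θ : ℝ) (n : ℕ),
      ∏ j ∈ Finset.range n, (θ + a j)
        = ∑ h ∈ Finset.range (n + 1), d h (n - h) * ∏ j ∈ Finset.range h, (θ - b j) := by
  intro θ n
  induction n with
  | zero => simp [hd00]
  | succ n ih =>
    rw [Finset.prod_range_succ, ih, Finset.sum_range_succ _ (n + 1),
      sum_range_stirling_antidiagonal_succ a b (fun h => ∏ j ∈ Finset.range h, (θ - b j)) d
        hd0t hdrec n n le_rfl,
      Nat.sub_self, hdh0, add_assoc]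
    have hlast : ∑ h ∈ Finset.range n, d h (n - h) * ∏ j ∈ Finset.range (h + 1), (θ - b j)
        + d n 0 * ∏ j ∈ Finset.range (n + 1), (θ - b j)
        = ∑ h ∈ Finset.range (n + 1), d h (n - h) * ∏ j ∈ Finset.range (h + 1), (θ - b j) := by
      rw [Finset.sum_range_succ _ n, Nat.sub_self]
    rw [hlast, ← Finset.sum_add_distrib, Finset.sum_mul]
    refine Finset.sum_congr rfl fun h _ => ?_
    rw [Finset.prod_range_succ]
    ring
end

section
/- Let (r_n)_{n≥1} be positive reals with Σ_n r_n < ∞, and for k ≥ 0 let e_k(r_1,r_2,…) = Σ_{i_1<…<i_k} r_{i_1}···r_{i_k} denote the (convergent) elementary symmetric function of degree k. Then lim_{h→∞} r_1 · e_{h−1}(r_2,r_3,…) / e_h(r_1,r_2,…) = 1. -/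
open Filter

/-- The elementary symmetric function of degree `k` of an infinite sequence `x`:
the sum over all `k`-element subsets of the index set of the products of the entries. -/
noncomputable def esymmInf (x : ℕ → ℝ) (k : ℕ) : ℝ :=
  ∑' s : {s : Finset ℕ // s.card = k}, ∏ i ∈ s.1, x i

theorem summable_esymmInf {x : ℕ → ℝ} (hx : ∀ n, 0 < x n) (hsum : Summable x) (k : ℕ) :
    Summable fun s : {s : Finset ℕ // s.card = k} => ∏ i ∈ s.1, x i :=
  (summable_finsetProd_of_summable_nonneg (fun n => (hx n).le) hsum).comp_injective
    Subtype.val_injective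

theorem esymmInf_pos {x : ℕ → ℝ} (hx : ∀ n, 0 < x n) (hsum : Summable x) (k : ℕ) :
    0 < esymmInf x k :=
  (summable_esymmInf hx hsum k).tsum_pos
    (fun _ => Finset.prod_nonneg fun i _ => (hx i).le) ⟨Finset.range k, Finset.card_range k⟩
    (Finset.prod_pos fun i _ => hx i)

theorem esymmInf_succ {x : ℕ → ℝ} (hx : ∀ n, 0 < x n) (hsum : Summable x) (k : ℕ) :
    esymmInf x (k + 1) =
      x 0 * esymmInf (fun n => x (n + 1)) k + esymmInf (fun n => x (n + 1)) (k + 1) := by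
  have hpos : ∀ n, 0 < x (n + 1) := fun n => hx (n + 1)
  have htail : Summable fun n => x (n + 1) := (summable_nat_add_iff 1).2 hsum
  let σ : ℕ ↪ ℕ := ⟨Nat.succ, Nat.succ_injective⟩
  have hσ : ∀ s : Finset ℕ, 0 ∉ s.map σ := by simp [σ]
  let f : {s : Finset ℕ // s.card = k} → {s : Finset ℕ // s.card = k + 1} := fun s =>
    ⟨insert 0 (s.1.map σ), by rw [Finset.card_insert_of_notMem (hσ _), Finset.card_map, s.2]⟩
  let g : {s : Finset ℕ // s.card = k + 1} → {s : Finset ℕ // s.card = k + 1} := fun s =>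
    ⟨s.1.map σ, by rw [Finset.card_map, s.2]⟩
  have hf : Function.Injective f := by
    intro s t hst
    have h := congrArg (fun u => u.1.erase 0) hst
    simp only [f, Finset.erase_insert (hσ _)] at h
    exact Subtype.ext (Finset.map_injective σ h)
  have hg : Function.Injective g := fun s t hst =>
    Subtype.ext (Finset.map_injective σ (congrArg Subtype.val hst))
  have preimage : ∀ s : Finset ℕ, 0 ∉ s → ∃ t : Finset ℕ, t.map σ = s := by
    intro s hs
    refine ⟨s.preimage σ σ.injective.injOn, ?_⟩
    ext n
    rcases n with _ | n <;> simp [σ, hs]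
  have hcompl : IsCompl (Set.range f) (Set.range g) := by
    refine ⟨Set.disjoint_left.2 ?_, codisjoint_iff_le_sup.2 fun s _ => ?_⟩
    · rintro _ ⟨s, rfl⟩ ⟨t, hst⟩
      have h : t.1.map σ = insert 0 (s.1.map σ) := congrArg Subtype.val hst
      exact hσ t.1 (h ▸ Finset.mem_insert_self _ _)
    · obtain ⟨s, hs⟩ := s
      by_cases h0 : 0 ∈ s
      · obtain ⟨t, ht⟩ := preimage (s.erase 0) (Finset.notMem_erase 0 s)
        have hcard : t.card = k := by
          rw [← Finset.card_map σ, ht, Finset.card_erase_of_mem h0, hs, Nat.add_sub_cancel]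
        exact Or.inl ⟨⟨t, hcard⟩, Subtype.ext (by simp only [f, ht, Finset.insert_erase h0])⟩
      · obtain ⟨t, ht⟩ := preimage s h0
        exact Or.inr ⟨⟨t, by rw [← Finset.card_map σ, ht, hs]⟩, Subtype.ext ht⟩
  refine (HasSum.add_isCompl hcompl (hf.hasSum_range_iff.2 ?_) (hg.hasSum_range_iff.2 ?_)).tsum_eq
  · refine ((summable_esymmInf hpos htail k).hasSum.mul_left (x 0)).congr_fun fun s => ?_
    simp [f, Finset.prod_insert (hσ _), σ]
  · refine (summable_esymmInf hpos htail (k + 1)).hasSum.congr_fun fun s => ?_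
    simp [g, σ]

theorem succ_mul_esymmInf_succ_le {x : ℕ → ℝ} (hx : ∀ n, 0 < x n) (hsum : Summable x) (k : ℕ) :
    (k + 1) * esymmInf x (k + 1) ≤ esymmInf x k * ∑' n, x n := by
  have hk := summable_esymmInf hx hsum k
  have hmul : Summable fun p : {s : Finset ℕ // s.card = k} × ℕ => (∏ i ∈ p.1.1, x i) * x p.2 :=
    hk.mul_of_nonneg hsum (fun _ => Finset.prod_nonneg fun i _ => (hx i).le) fun n => (hx n).le
  let e : (Σ s : {s : Finset ℕ // s.card = k + 1}, s.1) → {s : Finset ℕ // s.card = k} × ℕ :=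
    fun p => (⟨p.1.1.erase p.2.1, by
      rw [Finset.card_erase_of_mem p.2.2, p.1.2, Nat.add_sub_cancel]⟩, p.2.1)
  have he : Function.Injective e := by
    rintro ⟨⟨s, hs⟩, ⟨a, ha⟩⟩ ⟨⟨t, ht⟩, ⟨b, hb⟩⟩ h
    simp only [e, Prod.mk.injEq, Subtype.mk.injEq] at h
    obtain ⟨h, rfl⟩ := h
    obtain rfl : s = t := (Finset.insert_erase ha).symm.trans (h ▸ Finset.insert_erase hb)
    rfl
  have hval : ∀ p, (∏ i ∈ p.1.1, x i) = (∏ i ∈ (e p).1.1, x i) * x (e p).2 := fun p =>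
    (Finset.prod_erase_mul _ _ p.2.2).symm
  have hsig : Summable fun p : (Σ s : {s : Finset ℕ // s.card = k + 1}, s.1) =>
      ∏ i ∈ p.1.1, x i := by
    simp only [hval]
    exact hmul.comp_injective he
  calc (k + 1) * esymmInf x (k + 1)
      = ∑' p : (Σ s : {s : Finset ℕ // s.card = k + 1}, s.1), ∏ i ∈ p.1.1, x i := by
        rw [hsig.tsum_sigma, esymmInf, ← tsum_mul_left]
        refine tsum_congr fun s => ?_
        simp [s.2]
    _ ≤ ∑' p : {s : Finset ℕ // s.card = k} × ℕ, (∏ i ∈ p.1.1, x i) * x p.2 :=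
        hsig.tsum_le_tsum_of_inj e he
          (fun p _ => mul_nonneg (Finset.prod_nonneg fun i _ => (hx i).le) (hx _).le)
          (fun p => (hval p).le) hmul
    _ = esymmInf x k * ∑' n, x n := (hk.tsum_mul_tsum hsum hmul).symm

/-- For a summable sequence of positive reals `r_1, r_2, …` (here `r n` stands for `r_{n+1}`),
`r_1 · e_{h-1}(r_2, r_3, …) / e_h(r_1, r_2, …) → 1` as `h → ∞`. -/
theorem ratio_esymm_tendsto_one
    (r : ℕ → ℝ) (hr : ∀ n, 0 < r n) (hsum : Summable r) :
    Tendsto (fun h : ℕ => r 0 * esymmInf (fun n => r (n + 1)) h / esymmInf r (h + 1))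
      atTop (nhds 1) := by
  have hpos : ∀ n, 0 < r (n + 1) := fun n => hr (n + 1)
  have htail : Summable fun n => r (n + 1) := (summable_nat_add_iff 1).2 hsum
  set C := ∑' n, r (n + 1)
  have hlim : Tendsto (fun h : ℕ => 1 - C / r 0 * (1 / ((h : ℝ) + 1))) atTop (nhds 1) := by
    simpa using (tendsto_one_div_add_atTop_nhds_zero_nat (𝕜 := ℝ)).const_mul (C / r 0)
      |>.const_sub 1
  refine tendsto_of_tendsto_of_tendsto_of_le_of_le hlim tendsto_const_nhds (fun h => ?_)
    fun h => ?_
  · have ha := esymmInf_pos hpos htail h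
    have hb := esymmInf_pos hpos htail (h + 1)
    have hle := succ_mul_esymmInf_succ_le hpos htail h
    simp only [esymmInf_succ hr hsum]
    set a := esymmInf (fun n => r (n + 1)) h
    set b := esymmInf (fun n => r (n + 1)) (h + 1)
    have hr0 := hr 0
    have hra : 0 < r 0 * a := mul_pos hr0 ha
    have hsub : r 0 * a / (r 0 * a + b) = 1 - b / (r 0 * a + b) := by
      field_simp
      ring
    have h1 : b / (r 0 * a + b) ≤ b / (r 0 * a) := by
      gcongr
      linarith
    have h2 : b / (r 0 * a) ≤ C / r 0 * (1 / ((h : ℝ) + 1)) := by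
      rw [div_mul_div_comm, mul_one, div_le_div_iff₀ hra (by positivity)]
      nlinarith
    rw [hsub]
    linarith
  · have ha := esymmInf_pos hpos htail h
    have hb := esymmInf_pos hpos htail (h + 1)
    have hra := mul_pos (hr 0) ha
    simp only [esymmInf_succ hr hsum]
    exact div_le_one_of_le₀ (by linarith) (by linarith)
end

section
/- Let (x_n)_{n≥1} be positive reals with Σ_n x_n < ∞, and let e_k(x) = Σ_{i_1<…<i_k} x_{i_1}···x_{i_k} be the elementary symmetric function of degree k. Then for every k ≥ 0, e_k(x) ≤ (Σ_{n≥1} x_n)^k, and for every h ≥ 1, e_h(x) ≤ (Σ_{n≥h} x_n) · e_{h−1}(x); in particular e_h(x)/e_{h−1}(x) → 0 as h → ∞. -/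
open Filter

theorem sup_id_mem {h : ℕ} (s : {s : Finset ℕ // s.card = h + 1}) : s.1.sup id ∈ s.1 := by
  have hne : s.1.Nonempty := Finset.card_pos.1 (by rw [s.2]; omega)
  obtain ⟨m, hm, hms⟩ := Finset.exists_mem_eq_sup s.1 hne id
  rw [hms]
  exact hm

/-- Splitting off the largest element of a finite set with `h + 1` elements; that element is at
least `h`, and its excess over `h` is recorded. -/
def splitMax (h : ℕ) (s : {s : Finset ℕ // s.card = h + 1}) :
    ℕ × {s : Finset ℕ // s.card = h} :=
  (s.1.sup id - h, ⟨s.1.erase (s.1.sup id), by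
    rw [Finset.card_erase_of_mem (sup_id_mem s), s.2, Nat.add_sub_cancel]⟩)

theorem le_sup_id {h : ℕ} (s : {s : Finset ℕ // s.card = h + 1}) : h ≤ s.1.sup id := by
  have hsub : s.1 ⊆ Finset.range (s.1.sup id + 1) := fun i hi =>
    Finset.mem_range_succ_iff.2 (Finset.le_sup (f := id) hi)
  have hcard := Finset.card_le_card hsub
  rw [s.2, Finset.card_range] at hcard
  omega

theorem splitMax_injective (h : ℕ) : Function.Injective (splitMax h) := by
  intro s t hst
  have hmax : s.1.sup id - h = t.1.sup id - h := congrArg Prod.fst hst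
  have herase : s.1.erase (s.1.sup id) = t.1.erase (t.1.sup id) :=
    congrArg (fun p => p.2.1) hst
  have hsup : s.1.sup id = t.1.sup id := by
    have := le_sup_id s
    have := le_sup_id t
    omega
  apply Subtype.ext
  rw [← Finset.insert_erase (sup_id_mem s), ← Finset.insert_erase (sup_id_mem t), herase, hsup]

theorem mul_prod_splitMax (x : ℕ → ℝ) (h : ℕ) (s : {s : Finset ℕ // s.card = h + 1}) :
    x ((splitMax h s).1 + h) * ∏ i ∈ (splitMax h s).2.1, x i = ∏ i ∈ s.1, x i := by
  simp only [splitMax, Nat.sub_add_cancel (le_sup_id s)]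
  exact Finset.mul_prod_erase _ _ (sup_id_mem s)

theorem summable_mul_prod {x : ℕ → ℝ} (hx : ∀ n, 0 ≤ x n) (hsum : Summable x) {h : ℕ}
    (hh : Summable fun s : {s : Finset ℕ // s.card = h} => ∏ i ∈ s.1, x i) :
    Summable fun p : ℕ × {s : Finset ℕ // s.card = h} => x (p.1 + h) * ∏ i ∈ p.2.1, x i :=
  ((summable_nat_add_iff h).2 hsum).mul_of_nonneg hh (fun _ => hx _)
    (fun _ => Finset.prod_nonneg fun _ _ => hx _)

theorem summable_prod_card_eq {x : ℕ → ℝ} (hx : ∀ n, 0 ≤ x n) (hsum : Summable x) (k : ℕ) :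
    Summable fun s : {s : Finset ℕ // s.card = k} => ∏ i ∈ s.1, x i := by
  induction k with
  | zero =>
    have : Subsingleton {s : Finset ℕ // s.card = 0} :=
      ⟨fun s t => Subtype.ext <| by rw [Finset.card_eq_zero.1 s.2, Finset.card_eq_zero.1 t.2]⟩
    exact Summable.of_finite
  | succ h ih =>
    refine ((summable_mul_prod hx hsum ih).comp_injective (splitMax_injective h)).congr ?_
    exact fun s => mul_prod_splitMax x h s

theorem esymmInf_zero (x : ℕ → ℝ) : esymmInf x 0 = 1 := by
  rw [esymmInf, tsum_eq_single ⟨∅, rfl⟩]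
  · simp
  · exact fun s hs => (hs (Subtype.ext (Finset.card_eq_zero.1 s.2))).elim

theorem esymmInf_succ_le {x : ℕ → ℝ} (hx : ∀ n, 0 ≤ x n) (hsum : Summable x) (h : ℕ) :
    esymmInf x (h + 1) ≤ (∑' n, x (n + h)) * esymmInf x h := by
  have hh := summable_prod_card_eq hx hsum h
  have hprod := summable_mul_prod hx hsum hh
  rw [esymmInf, esymmInf, ((summable_nat_add_iff h).2 hsum).tsum_mul_tsum hh hprod]
  exact (summable_prod_card_eq hx hsum (h + 1)).tsum_le_tsum_of_inj (splitMax h)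
    (splitMax_injective h)
    (fun _ _ => mul_nonneg (hx _) (Finset.prod_nonneg fun _ _ => hx _))
    (fun s => (mul_prod_splitMax x h s).ge) hprod

theorem tsum_nat_add_le {x : ℕ → ℝ} (hx : ∀ n, 0 ≤ x n) (hsum : Summable x) (h : ℕ) :
    ∑' n, x (n + h) ≤ ∑' n, x n := by
  rw [← hsum.sum_add_tsum_nat_add h]
  exact le_add_of_nonneg_left (Finset.sum_nonneg fun _ _ => hx _)

/-- For a summable sequence of positive reals `x_1, x_2, …` (here `x n` stands for `x_{n+1}`):
`e_k(x) ≤ (∑ x_n)^k`; for every `h ≥ 1`, `e_h(x) ≤ (∑_{n ≥ h} x_n) · e_{h-1}(x)`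
(stated with `h+1` in place of `h`); and consequently `e_h(x)/e_{h-1}(x) → 0`. -/
theorem esymm_bounds_and_ratio_tendsto_zero
    (x : ℕ → ℝ) (hx : ∀ n, 0 < x n) (hsum : Summable x) :
    (∀ k : ℕ, esymmInf x k ≤ (∑' n, x n) ^ k) ∧
    (∀ h : ℕ, esymmInf x (h + 1) ≤ (∑' n, x (n + h)) * esymmInf x h) ∧
    Tendsto (fun h : ℕ => esymmInf x (h + 1) / esymmInf x h) atTop (nhds 0) := by
  have hx' : ∀ n, 0 ≤ x n := fun n => (hx n).le
  have hsucc := esymmInf_succ_le hx' hsum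
  refine ⟨fun k => ?_, hsucc, ?_⟩
  · induction k with
    | zero => rw [esymmInf_zero, pow_zero]
    | succ k ih =>
      calc esymmInf x (k + 1) ≤ (∑' n, x (n + k)) * esymmInf x k := hsucc k
        _ ≤ (∑' n, x n) * (∑' n, x n) ^ k :=
          mul_le_mul (tsum_nat_add_le hx' hsum k) ih (esymmInf_pos hx hsum k).le (tsum_nonneg hx')
        _ = (∑' n, x n) ^ (k + 1) := (pow_succ' _ _).symm
  · exact squeeze_zero
      (fun h => div_nonneg (esymmInf_pos hx hsum _).le (esymmInf_pos hx hsum _).le)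
      (fun h => (div_le_iff₀ (esymmInf_pos hx hsum h)).2 (hsucc h)) (tendsto_sum_nat_add x)
end

section
/- Fix q ∈ (0,1). Let (c_n)_{n≥0} be a real sequence with c_0 = 1, and let φ : ℕ×ℕ → ℝ be the (uniquely determined) array with φ(n,0) = c_n for all n and satisfying the recursion φ(h,t) = q^h·φ(h,t+1) + φ(h+1,t) for all (h,t), i.e., φ(h,t+1) = q^{−h}(φ(h,t) − φ(h+1,t)). Then φ(h,t) ≥ 0 for all (h,t) if and only if there exist nonnegative reals μ_∞ and (μ_m)_{m≥0} with μ_∞ + Σ_{m≥0} μ_m = 1 such that c_n = μ_∞·𝟙{n=0} + Σ_{m=0}^{∞} μ_m q^{mn} for all n ≥ 0; that is, (c_n) is a moment sequence of a probability measure on the set {q^m : m ≥ 0} ∪ {0}. -/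
open Filter Topology in
/-- A real sequence that is antitone with limit zero is nonnegative. -/
theorem nonneg_of_succ_le_of_tendsto_zero {u : ℕ → ℝ} (hu : ∀ n, u (n + 1) ≤ u n)
    (hlim : Tendsto u atTop (𝓝 0)) (n : ℕ) : 0 ≤ u n :=
  (antitone_nat_of_succ_le hu).le_of_tendsto hlim n

/-- The solution of the `q`-Pascal recursion with boundary values `x ^ n`. -/
noncomputable def qPascalKernel (q x : ℝ) (h t : ℕ) : ℝ :=
  (x / q ^ t) ^ h * ∏ i ∈ Finset.range t, (1 - x / q ^ i)

theorem qPascalKernel_zero_right (q x : ℝ) (h : ℕ) : qPascalKernel q x h 0 = x ^ h := by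
  simp [qPascalKernel]

theorem qPascalKernel_rec {q : ℝ} (hq : q ≠ 0) (x : ℝ) (h t : ℕ) :
    qPascalKernel q x h t
      = q ^ h * qPascalKernel q x h (t + 1) + qPascalKernel q x (h + 1) t := by
  have hx : x / q ^ t = q * (x / q ^ (t + 1)) := by field_simp; ring
  have hpow : (x / q ^ t) ^ h = q ^ h * (x / q ^ (t + 1)) ^ h := by rw [hx, mul_pow]
  simp only [qPascalKernel, Finset.prod_range_succ]
  linear_combination -(∏ i ∈ Finset.range t, (1 - x / q ^ i)) * (1 - x / q ^ t) * (-hpow)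

theorem qPascalKernel_pow_eq_zero {q : ℝ} (hq : q ≠ 0) {m t : ℕ} (hmt : m < t) (h : ℕ) :
    qPascalKernel q (q ^ m) h t = 0 := by
  have : ∏ i ∈ Finset.range t, (1 - q ^ m / q ^ i) = 0 :=
    Finset.prod_eq_zero (Finset.mem_range.2 hmt) (by rw [div_self (pow_ne_zero _ hq), sub_self])
  rw [qPascalKernel, this, mul_zero]

theorem pow_div_pow_lt_one {q : ℝ} (hq0 : 0 < q) (hq1 : q < 1) {i m : ℕ} (him : i < m) :
    q ^ m / q ^ i < 1 :=
  (div_lt_one (pow_pos hq0 i)).2 (pow_lt_pow_right_of_lt_one₀ hq0 hq1 him)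

theorem qPascalKernel_prod_pos {q : ℝ} (hq0 : 0 < q) (hq1 : q < 1) {m t : ℕ} (htm : t ≤ m) :
    0 < ∏ i ∈ Finset.range t, (1 - q ^ m / q ^ i) :=
  Finset.prod_pos fun _ hi =>
    sub_pos.2 (pow_div_pow_lt_one hq0 hq1 ((Finset.mem_range.1 hi).trans_le htm))

theorem qPascalKernel_pow_nonneg {q : ℝ} (hq0 : 0 < q) (hq1 : q < 1) (m h t : ℕ) :
    0 ≤ qPascalKernel q (q ^ m) h t := by
  rcases lt_or_ge m t with hmt | htm
  · rw [qPascalKernel_pow_eq_zero hq0.ne' hmt]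
  · exact mul_nonneg (by positivity) (qPascalKernel_prod_pos hq0 hq1 htm).le

theorem qPascalKernel_zero_nonneg (q : ℝ) (h t : ℕ) : 0 ≤ qPascalKernel q 0 h t := by
  simp [qPascalKernel, pow_nonneg]

theorem qPascalKernel_diag {q : ℝ} (hq : q ≠ 0) (h t : ℕ) :
    qPascalKernel q (q ^ t) h t = ∏ i ∈ Finset.range t, (1 - q ^ t / q ^ i) := by
  rw [qPascalKernel, div_self (pow_ne_zero _ hq), one_pow, one_mul]

open Filter Topology in
theorem tendsto_qPascalKernel_pow {q : ℝ} (hq0 : 0 < q) (hq1 : q < 1) {m t : ℕ} (hmt : m ≠ t) :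
    Tendsto (fun h => qPascalKernel q (q ^ m) h t) atTop (𝓝 0) := by
  rcases hmt.lt_or_gt with hmt | htm
  · simp [qPascalKernel_pow_eq_zero hq0.ne' hmt]
  · simpa [qPascalKernel] using
      (tendsto_pow_atTop_nhds_zero_of_lt_one (by positivity)
        (pow_div_pow_lt_one hq0 hq1 htm)).mul_const (∏ i ∈ Finset.range t, (1 - q ^ m / q ^ i))

/-- Integrating the kernel against a measure on `{q ^ m} ∪ {0}` solves the recursion. -/
theorem hasSum_qPascalKernel {q : ℝ} (hq : q ≠ 0) {φ : ℕ × ℕ → ℝ}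
    (hrec : ∀ h t, φ (h, t) = q ^ h * φ (h, t + 1) + φ (h + 1, t)) {a : ℝ} {μ : ℕ → ℝ}
    (h0 : ∀ h, HasSum (fun m => μ m * qPascalKernel q (q ^ m) h 0)
      (φ (h, 0) - a * qPascalKernel q 0 h 0)) (t h : ℕ) :
    HasSum (fun m => μ m * qPascalKernel q (q ^ m) h t)
      (φ (h, t) - a * qPascalKernel q 0 h t) := by
  induction t generalizing h with
  | zero => exact h0 h
  | succ t ih =>
    have hqh : q ^ h ≠ 0 := pow_ne_zero _ hq
    have hsum := ((ih h).sub (ih (h + 1))).mul_left (q ^ h)⁻¹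
    have hval : (q ^ h)⁻¹ * (φ (h, t) - a * qPascalKernel q 0 h t
        - (φ (h + 1, t) - a * qPascalKernel q 0 (h + 1) t))
        = φ (h, t + 1) - a * qPascalKernel q 0 h (t + 1) := by
      rw [hrec h t, qPascalKernel_rec hq 0 h t, inv_mul_eq_iff_eq_mul₀ hqh]
      ring
    rw [hval] at hsum
    refine (funext fun m => ?_ : (fun m => μ m * qPascalKernel q (q ^ m) h (t + 1)) = _) ▸ hsum
    rw [qPascalKernel_rec hq (q ^ m) h t, eq_inv_mul_iff_mul_eq₀ hqh]
    ring

open Filter Topology in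
/-- If the columns `t < T` of a solution of the recursion tend to zero, and column `T` is
nonnegative and antitone, then the columns `t ≤ T` are nonnegative and decay geometrically. -/
theorem qPascal_nonneg_and_decay {q : ℝ} (hq0 : 0 < q) {ψ : ℕ → ℕ → ℝ}
    (hrec : ∀ h t, ψ h t = q ^ h * ψ h (t + 1) + ψ (h + 1) t) {T : ℕ}
    (hlim : ∀ t < T, Tendsto (fun h => ψ h t) atTop (𝓝 0))
    (hT : ∀ h, 0 ≤ ψ h T) (hT' : ∀ h, ψ (h + 1) T ≤ ψ h T) (k : ℕ) :
    ∀ t, t + k = T → ∀ h, 0 ≤ ψ h t ∧ ψ (h + 1) t ≤ q ^ k * ψ h t := by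
  induction k with
  | zero =>
    rintro t rfl h
    exact ⟨hT h, by simpa using hT' h⟩
  | succ k ih =>
    intro t ht h
    have ih := ih (t + 1) (by omega)
    have hl := hlim t (by omega)
    refine ⟨nonneg_of_succ_le_of_tendsto_zero (fun n => ?_) hl h, ?_⟩
    · have := mul_nonneg (pow_nonneg hq0.le n) (ih n).1
      linarith [hrec n t]
    · refine sub_nonneg.1 (nonneg_of_succ_le_of_tendsto_zero
        (u := fun n => q ^ (k + 1) * ψ n t - ψ (n + 1) t) (fun n => ?_) ?_ h)
      · have hstep := mul_nonneg (pow_nonneg hq0.le (n + 1)) (sub_nonneg.2 (ih n).2)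
        have hdiff : q ^ (k + 1) * ψ n t - ψ (n + 1) t
            - (q ^ (k + 1) * ψ (n + 1) t - ψ (n + 1 + 1) t)
            = q ^ (n + 1) * (q ^ k * ψ n (t + 1) - ψ (n + 1) (t + 1)) := by
          linear_combination q ^ (k + 1) * hrec n t - hrec (n + 1) t
        linarith
      · simpa using (hl.const_mul (q ^ (k + 1))).sub (hl.comp (tendsto_add_atTop_nat 1))

open Filter Topology in
/-- A nonnegative solution of the recursion is represented by a measure on `{q ^ m}`, up to an
error at boundary points `(h, 0)` that decays geometrically for `h ≥ 1`. -/
theorem qPascal_exists_weights {q : ℝ} (hq0 : 0 < q) (hq1 : q < 1) {φ : ℕ × ℕ → ℝ}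
    (hrec : ∀ h t, φ (h, t) = q ^ h * φ (h, t + 1) + φ (h + 1, t))
    (hφ : ∀ h t, 0 ≤ φ (h, t)) :
    ∃ μ : ℕ → ℝ, (∀ m, 0 ≤ μ m) ∧ ∀ T h,
      0 ≤ φ (h, 0) - ∑ m ∈ Finset.range T, μ m * q ^ (m * h) ∧
      φ (h + 1, 0) - ∑ m ∈ Finset.range T, μ m * q ^ (m * (h + 1))
        ≤ q ^ T * (φ (h, 0) - ∑ m ∈ Finset.range T, μ m * q ^ (m * h)) := by
  have hanti (t h : ℕ) : φ (h + 1, t) ≤ φ (h, t) := by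
    have := mul_nonneg (pow_nonneg hq0.le h) (hφ h (t + 1))
    linarith [hrec h t]
  have hex (t : ℕ) : ∃ l : ℝ, 0 ≤ l ∧ Tendsto (fun h => φ (h, t)) atTop (𝓝 l) := by
    have hlim := tendsto_atTop_ciInf
      (antitone_nat_of_succ_le (f := fun h => φ (h, t)) (hanti t))
      ⟨0, by rintro _ ⟨h, rfl⟩; exact hφ h t⟩
    exact ⟨_, le_ciInf fun h => hφ h t, hlim⟩
  choose l hl0 hl using hex
  set P : ℕ → ℝ := fun t => ∏ i ∈ Finset.range t, (1 - q ^ t / q ^ i)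
  have hPpos (t : ℕ) : 0 < P t := qPascalKernel_prod_pos hq0 hq1 le_rfl
  refine ⟨fun t => l t / P t, fun t => div_nonneg (hl0 t) (hPpos t).le, fun T h => ?_⟩
  set ψ : ℕ → ℕ → ℝ := fun h t =>
    φ (h, t) - ∑ m ∈ Finset.range T, l m / P m * qPascalKernel q (q ^ m) h t with hψ
  have hψT (h : ℕ) : ψ h T = φ (h, T) := by
    simp only [hψ]
    rw [Finset.sum_eq_zero, sub_zero]
    intro m hm
    rw [qPascalKernel_pow_eq_zero hq0.ne' (Finset.mem_range.1 hm), mul_zero]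
  have hψrec (h t : ℕ) : ψ h t = q ^ h * ψ h (t + 1) + ψ (h + 1) t := by
    have hsum : ∑ m ∈ Finset.range T, l m / P m * qPascalKernel q (q ^ m) h t
        = q ^ h * ∑ m ∈ Finset.range T, l m / P m * qPascalKernel q (q ^ m) h (t + 1)
          + ∑ m ∈ Finset.range T, l m / P m * qPascalKernel q (q ^ m) (h + 1) t := by
      rw [Finset.mul_sum, ← Finset.sum_add_distrib]
      refine Finset.sum_congr rfl fun m _ => ?_
      rw [qPascalKernel_rec hq0.ne' _ h t]
      ring
    simp only [hψ]
    linear_combination hrec h t - hsum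
  have hψlim (t : ℕ) (ht : t < T) : Tendsto (fun h => ψ h t) atTop (𝓝 0) := by
    have hterm (m : ℕ) : Tendsto (fun h => l m / P m * qPascalKernel q (q ^ m) h t) atTop
        (𝓝 (if m = t then l t else 0)) := by
      split_ifs with hmt
      · subst hmt
        simp only [qPascalKernel_diag hq0.ne']
        rw [div_mul_cancel₀ _ (hPpos m).ne']
        exact tendsto_const_nhds
      · simpa using (tendsto_qPascalKernel_pow hq0 hq1 hmt).const_mul (l m / P m)
    have := (hl t).sub (tendsto_finsetSum (Finset.range T) fun m _ => hterm m)
    simpa [ht] using this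
  have key := qPascal_nonneg_and_decay hq0 hψrec hψlim (fun h => hψT h ▸ hφ h T)
    (fun h => by rw [hψT, hψT]; exact hanti T h) T 0 (zero_add T) h
  simpa only [hψ, qPascalKernel_zero_right, ← pow_mul] using key

/-- The moment problem for the q-Pascal triangle: the array `φ` determined by the boundary data
`φ(n,0) = c_n` and the recursion `φ(h,t) = q^h φ(h,t+1) + φ(h+1,t)` is nonnegative if and only
if `(c_n)` is the moment sequence of a probability measure on `{q^m : m ≥ 0} ∪ {0}`. -/
theorem qPascal_moment_problem
    (q : ℝ) (hq : q ∈ Set.Ioo (0 : ℝ) 1)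
    (c : ℕ → ℝ) (hc0 : c 0 = 1)
    (φ : ℕ × ℕ → ℝ)
    (hφ0 : ∀ n, φ (n, 0) = c n)
    (hφrec : ∀ h t, φ (h, t) = q ^ h * φ (h, t + 1) + φ (h + 1, t)) :
    (∀ h t, 0 ≤ φ (h, t))
      ↔ ∃ (μinf : ℝ) (μ : ℕ → ℝ),
          0 ≤ μinf ∧ (∀ m, 0 ≤ μ m) ∧ Summable μ ∧ μinf + ∑' m, μ m = 1 ∧
          ∀ n, c n = (if n = 0 then μinf else 0) + ∑' m, μ m * q ^ (m * n) := by
  obtain ⟨hq0, hq1⟩ := hq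
  constructor
  · intro hφ
    obtain ⟨μ, hμ, hμφ⟩ := qPascal_exists_weights hq0 hq1 hφrec hφ
    simp only [hφ0] at hμφ
    have hsum : Summable μ := summable_of_sum_range_le (c := 1) hμ fun T => by
      simpa [hc0] using (hμφ T 0).1
    have hle : ∑' m, μ m ≤ 1 := hsum.tsum_le_of_sum_range_le fun T => by
      simpa [hc0] using (hμφ T 0).1
    refine ⟨1 - ∑' m, μ m, μ, sub_nonneg.2 hle, hμ, hsum, sub_add_cancel _ _, fun n => ?_⟩
    cases n with
    | zero => simp [hc0]
    | succ h =>
      have hnn (m : ℕ) : 0 ≤ μ m * q ^ (m * (h + 1)) := mul_nonneg (hμ m) (by positivity)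
      have herr : Filter.Tendsto
          (fun T => c (h + 1) - ∑ m ∈ Finset.range T, μ m * q ^ (m * (h + 1)))
          Filter.atTop (nhds 0) := by
        refine squeeze_zero (g := fun T => q ^ T * c h) (fun T => (hμφ T (h + 1)).1)
          (fun T => (hμφ T h).2.trans ?_) ?_
        · refine mul_le_mul_of_nonneg_left (sub_le_self _ ?_) (by positivity)
          exact Finset.sum_nonneg fun m _ => mul_nonneg (hμ m) (by positivity)
        · simpa using (tendsto_pow_atTop_nhds_zero_of_lt_one hq0.le hq1).mul_const (c h)
      have hs : HasSum (fun m => μ m * q ^ (m * (h + 1))) (c (h + 1)) := by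
        rw [hasSum_iff_tendsto_nat_of_nonneg hnn]
        simpa using herr.const_sub (c (h + 1))
      simp [hs.tsum_eq]
  · rintro ⟨a, μ, ha, hμ, hsum, -, hc⟩ h t
    have hsumq (n : ℕ) : Summable fun m => μ m * q ^ (m * n) :=
      hsum.of_nonneg_of_le (fun m => mul_nonneg (hμ m) (by positivity)) fun m =>
        mul_le_of_le_one_right (hμ m) (pow_le_one₀ hq0.le hq1.le)
    have hs := hasSum_qPascalKernel hq0.ne' hφrec (a := a) (μ := μ) (fun n => by
      have hval : φ (n, 0) - a * qPascalKernel q 0 n 0 = ∑' m, μ m * q ^ (m * n) := by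
        rw [hφ0, hc, qPascalKernel_zero_right, zero_pow_eq]
        split_ifs <;> ring
      rw [hval]
      simpa only [qPascalKernel_zero_right, ← pow_mul] using (hsumq n).hasSum) t h
    have hnn := hs.nonneg fun m => mul_nonneg (hμ m) (qPascalKernel_pow_nonneg hq0 hq1 m h t)
    linarith [mul_nonneg ha (qPascalKernel_zero_nonneg q h t)]
end

section
/- Fix q ∈ (0,1) and m ≥ 0. Define φ : ℕ×ℕ → ℝ by φ(h,t) = q^{(m−t)h}·∏_{j=0}^{t−1}(1 − q^{m−j}) for 0 ≤ t ≤ m, and φ(h,t) = 0 for t > m. Then φ(0,0) = 1, φ(h,t) ≥ 0 for all (h,t), and φ satisfies the forward recursion of the q-Pascal triangle: φ(h,t) = q^h·φ(h,t+1) + φ(h+1,t) for all (h,t) ∈ ℕ×ℕ. (This φ is the probability function of the finitely supported ergodic measure of the q-Pascal triangle supported by paths with at most m tails.) -/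
open Finset

/-- The probability function of the finitely supported ergodic measure `Q_{m,∞}` of the
q-Pascal triangle: `φ(h,t) = q^{(m-t)h} ∏_{j<t}(1-q^{m-j})` for `t ≤ m` and `0` for `t > m`
is nonnegative, normalized, and satisfies the forward recursion
`φ(h,t) = q^h φ(h,t+1) + φ(h+1,t)`. -/
theorem qPascal_finitely_supported_probability_function
    (q : ℝ) (hq : q ∈ Set.Ioo (0 : ℝ) 1) (m : ℕ)
    (φ : ℕ × ℕ → ℝ)
    (hφ : ∀ h t, φ (h, t) =
      if t ≤ m then q ^ ((m - t) * h) * ∏ j ∈ Finset.range t, (1 - q ^ (m - j)) else 0) :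
    φ (0, 0) = 1 ∧ (∀ h t, 0 ≤ φ (h, t)) ∧
      ∀ h t, φ (h, t) = q ^ h * φ (h, t + 1) + φ (h + 1, t) := by
  obtain ⟨hq0, hq1⟩ := hq
  refine ⟨by simp [hφ], fun h t => ?_, fun h t => ?_⟩
  · rw [hφ]
    split_ifs
    · exact mul_nonneg (pow_nonneg hq0.le _)
        (Finset.prod_nonneg fun j _ => sub_nonneg.2 (pow_le_one₀ hq0.le hq1.le))
    · exact le_rfl
  · simp only [hφ]
    rcases lt_trichotomy t m with htm | rfl | htm
    · obtain ⟨d, rfl⟩ : ∃ d, m = t + 1 + d := Nat.exists_eq_add_of_le htm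
      have h₁ : t + 1 + d - t = d + 1 := by omega
      have h₂ : t + 1 + d - (t + 1) = d := by omega
      rw [if_pos (by omega), if_pos (by omega), if_pos (by omega), Finset.prod_range_succ, h₁, h₂]
      ring
    · simp
    · rw [if_neg (by omega), if_neg (by omega), if_neg (by omega)]
      ring
end

section
/- Let a, b > 0 and let (X_n)_{n≥1} be a sequence of {0,1}-valued random variables, adapted to a filtration (ℱ_n), such that almost surely ℙ(X_{n+1} = 1 | ℱ_n) = (n − H_n + a)/(n + a + b) for all n ≥ 0, where H_n = Σ_{k=1}^{n} X_k (Friedman's urn dynamics: the probability of a head equals the current proportion of 'tail' weight). Then H_n/n → 1/2 almost surely. -/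
open MeasureTheory Filter Finset

/-- The second moment of a bounded process with steps `2 * x - 1`, `x ∈ {0, 1}`, whose conditional
drift points towards the origin grows by at most one at each step. -/
theorem integral_sq_add_le_of_condExp_eq {Ω : Type*} {m mΩ : MeasurableSpace Ω} {μ : Measure Ω}
    [IsProbabilityMeasure μ] (hm : m ≤ mΩ) {z x : Ω → ℝ} {B r : ℝ}
    (hz : Measurable[m] z) (hzB : ∀ ω, |z ω| ≤ B) (hx : Measurable x)
    (hx01 : ∀ ω, x ω = 0 ∨ x ω = 1) (hr : 0 < r)
    (hcond : μ[x | m] =ᵐ[μ] fun ω => 1 / 2 - z ω / (2 * r)) :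
    ∫ ω, (z ω + (2 * x ω - 1)) ^ 2 ∂μ ≤ ∫ ω, z ω ^ 2 ∂μ + 1 := by
  have hzm : Measurable z := hz.mono hm le_rfl
  have hzi : Integrable z μ :=
    Integrable.of_bound hzm.aestronglyMeasurable B (.of_forall fun ω => by simpa using hzB ω)
  have hxi : Integrable x μ :=
    Integrable.of_bound hx.aestronglyMeasurable 1
      (.of_forall fun ω => by rcases hx01 ω with h | h <;> simp [h])
  have hzxi : Integrable (fun ω => z ω * x ω) μ :=
    hxi.bdd_mul hzm.aestronglyMeasurable (.of_forall fun ω => by simpa using hzB ω)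
  have hz2i : Integrable (fun ω => z ω ^ 2) μ := by
    simpa only [sq] using
      hzi.bdd_mul hzm.aestronglyMeasurable (.of_forall fun ω => by simpa using hzB ω)
  have hzx : ∫ ω, z ω * x ω ∂μ = (∫ ω, z ω ∂μ) / 2 - (∫ ω, z ω ^ 2 ∂μ) / (2 * r) := by
    have hpull : μ[fun ω => z ω * x ω | m] =ᵐ[μ] fun ω => z ω / 2 - z ω ^ 2 / (2 * r) := by
      filter_upwards [condExp_mul_of_stronglyMeasurable_left hz.stronglyMeasurable hzxi hxi,
        hcond] with ω h₁ h₂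
      have h₁' : (μ[fun ω => z ω * x ω | m]) ω = z ω * (μ[x | m]) ω := h₁
      rw [h₁', h₂]
      ring
    rw [← integral_condExp hm, integral_congr_ae hpull,
      integral_sub (hzi.div_const 2) (hz2i.div_const (2 * r)), integral_div, integral_div]
  have hexpand : ∀ ω, (z ω + (2 * x ω - 1)) ^ 2 = z ω ^ 2 + 4 * (z ω * x ω) - 2 * z ω + 1 := by
    intro ω
    rcases hx01 ω with h | h <;> rw [h] <;> ring
  have hsq : 0 ≤ (∫ ω, z ω ^ 2 ∂μ) / (2 * r) :=
    div_nonneg (integral_nonneg fun ω => sq_nonneg _) (by positivity)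
  have hsum : ∫ ω, (z ω + (2 * x ω - 1)) ^ 2 ∂μ
      = ∫ ω, z ω ^ 2 ∂μ + 4 * ∫ ω, z ω * x ω ∂μ - 2 * ∫ ω, z ω ∂μ + 1 := by
    simp_rw [hexpand]
    have h₁ : Integrable (fun ω => z ω ^ 2 + 4 * (z ω * x ω)) μ := hz2i.add (hzxi.const_mul 4)
    have h₂ : Integrable (fun ω => z ω ^ 2 + 4 * (z ω * x ω) - 2 * z ω) μ :=
      h₁.sub (hzi.const_mul 2)
    rw [integral_add h₂ (integrable_const 1), integral_sub h₁ (hzi.const_mul 2),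
      integral_add hz2i (hzxi.const_mul 4), integral_const_mul, integral_const_mul]
    simp
  rw [hsum, hzx]
  linarith

/-- If the second moment of `Z n` grows at most linearly, then `Z (k ^ 2) / k ^ 2` tends to zero
almost surely. -/
theorem ae_tendsto_div_sq_of_integral_sq_le {Ω : Type*} {mΩ : MeasurableSpace Ω} {μ : Measure Ω}
    {Z : ℕ → Ω → ℝ} {C : ℝ} (hZ : ∀ n, Integrable (fun ω => Z n ω ^ 2) μ)
    (hle : ∀ n : ℕ, ∫ ω, Z n ω ^ 2 ∂μ ≤ C + n) :
    ∀ᵐ ω ∂μ, Tendsto (fun k : ℕ => Z (k ^ 2) ω / (k : ℝ) ^ 2) atTop (nhds 0) := by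
  have hbound : ∀ k : ℕ, ∫ ω, (Z (k ^ 2) ω / (k : ℝ) ^ 2) ^ 2 ∂μ
      ≤ C * (1 / (k : ℝ) ^ 4) + 1 / (k : ℝ) ^ 2 := by
    intro k
    rcases Nat.eq_zero_or_pos k with rfl | hk
    · simp
    · have hk' : (0 : ℝ) < k := by exact_mod_cast hk
      simp_rw [div_pow]
      rw [integral_div, div_le_iff₀ (by positivity)]
      refine (hle (k ^ 2)).trans (le_of_eq ?_)
      push_cast
      field_simp
  have hsummable : Summable fun k : ℕ => C * (1 / (k : ℝ) ^ 4) + 1 / (k : ℝ) ^ 2 :=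
    ((Real.summable_one_div_nat_pow.2 (by norm_num)).mul_left C).add
      (Real.summable_one_div_nat_pow.2 (by norm_num))
  have hint : ∀ k : ℕ, Integrable (fun ω => (Z (k ^ 2) ω / (k : ℝ) ^ 2) ^ 2) μ := by
    intro k
    simp_rw [div_pow]
    exact (hZ _).div_const _
  have hfin : ∑' k : ℕ, ∫⁻ ω, ENNReal.ofReal ((Z (k ^ 2) ω / (k : ℝ) ^ 2) ^ 2) ∂μ ≠ ⊤ := by
    refine ne_top_of_le_ne_top hsummable.tsum_ofReal_ne_top (ENNReal.tsum_le_tsum fun k => ?_)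
    rw [← ofReal_integral_eq_lintegral_ofReal (hint k) (.of_forall fun ω => sq_nonneg _)]
    exact ENNReal.ofReal_le_ofReal (hbound k)
  have hmeas : ∀ k : ℕ,
      AEMeasurable (fun ω => ENNReal.ofReal ((Z (k ^ 2) ω / (k : ℝ) ^ 2) ^ 2)) μ :=
    fun k => (hint k).aestronglyMeasurable.aemeasurable.ennreal_ofReal
  rw [← lintegral_tsum hmeas] at hfin
  filter_upwards [ae_lt_top' (AEMeasurable.tsum hmeas) hfin] with ω hω
  have h := (ENNReal.tendsto_toReal ENNReal.zero_ne_top).comp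
    (ENNReal.tendsto_atTop_zero_of_tsum_ne_top hω.ne)
  have h' : Tendsto (fun k : ℕ => (Z (k ^ 2) ω / (k : ℝ) ^ 2) ^ 2) atTop (nhds 0) := by
    simpa [Function.comp_def, ENNReal.toReal_ofReal, sq_nonneg] using h
  rw [tendsto_zero_iff_abs_tendsto_zero]
  simpa [Function.comp_def, Real.sqrt_sq_eq_abs] using h'.sqrt

/-- For a sequence with steps bounded by one, convergence to zero of the averages along the squares
implies convergence to zero of the averages. -/
theorem tendsto_div_nat_of_tendsto_div_sq {z : ℕ → ℝ} (hstep : ∀ n, |z (n + 1) - z n| ≤ 1)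
    (hz : Tendsto (fun k : ℕ => z (k ^ 2) / (k : ℝ) ^ 2) atTop (nhds 0)) :
    Tendsto (fun n : ℕ => z n / n) atTop (nhds 0) := by
  have hgap : ∀ n j : ℕ, |z (n + j) - z n| ≤ j := by
    intro n j
    induction j with
    | zero => simp
    | succ j ih =>
      have := abs_sub_le (z (n + (j + 1))) (z (n + j)) (z n)
      have := hstep (n + j)
      push_cast
      rw [← add_assoc] at *
      linarith
  have hsqrt : Tendsto Nat.sqrt atTop atTop :=
    tendsto_atTop_mono' atTop (.of_forall fun n => le_rfl) <| tendsto_atTop.2 fun k =>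
      (eventually_ge_atTop (k * k)).mono fun n hn => Nat.le_sqrt.2 hn
  have hmajor : Tendsto (fun k : ℕ => |z (k ^ 2) / (k : ℝ) ^ 2| + 2 / (k : ℝ)) atTop (nhds 0) := by
    simpa using hz.abs.add (tendsto_const_div_atTop_nhds_zero_nat (2 : ℝ))
  refine squeeze_zero_norm' ?_ (hmajor.comp hsqrt)
  filter_upwards [eventually_ge_atTop 1] with n hn
  set k := Nat.sqrt n with hk
  have hk0 : (0 : ℝ) < k := by exact_mod_cast Nat.sqrt_pos.2 hn
  have hkn : k ^ 2 ≤ n := Nat.sqrt_le' n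
  obtain ⟨j, hj⟩ := Nat.exists_eq_add_of_le hkn
  have hj2 : j ≤ 2 * k := by
    have := Nat.sqrt_le_add n
    rw [← hk] at this
    nlinarith
  have hj2' : (j : ℝ) ≤ 2 * k := by exact_mod_cast hj2
  have hkn' : (k : ℝ) ^ 2 ≤ n := by exact_mod_cast hkn
  have hzn : |z n| ≤ |z (k ^ 2)| + 2 * k := by
    have h₁ := hgap (k ^ 2) j
    rw [← hj] at h₁
    have h₂ := abs_sub_abs_le_abs_sub (z n) (z (k ^ 2))
    linarith
  calc ‖z n / n‖ = |z n| / n := by simp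
    _ ≤ (|z (k ^ 2)| + 2 * k) / (k : ℝ) ^ 2 := by gcongr
    _ = |z (k ^ 2) / (k : ℝ) ^ 2| + 2 / (k : ℝ) := by
      rw [abs_div, abs_of_pos (by positivity : (0 : ℝ) < (k : ℝ) ^ 2)]
      field_simp

/-- Friedman's urn: if the probability of a head at trial `n+1` given the past is
`(n - H_n + a)/(n + a + b)` (the current proportion of 'tail' weight), then the proportion of
heads converges almost surely to `1/2`. -/
theorem friedman_urn_concentration
    {Ω : Type*} {mΩ : MeasurableSpace Ω} (μ : Measure Ω) [IsProbabilityMeasure μ]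
    (a b : ℝ) (ha : 0 < a) (hb : 0 < b)
    (ℱ : Filtration ℕ mΩ)
    (X : ℕ → Ω → ℕ)
    (hX01 : ∀ n ω, X n ω ≤ 1)
    (hadapted : Adapted ℱ (fun n ω => (X n ω : ℝ)))
    (H : ℕ → Ω → ℕ) (hH : ∀ n ω, H n ω = ∑ k ∈ Finset.Icc 1 n, X k ω)
    (hcond : ∀ n : ℕ,
      μ[fun ω => (X (n + 1) ω : ℝ) | ℱ n]
        =ᵐ[μ] fun ω => ((n : ℝ) - H n ω + a) / ((n : ℝ) + a + b)) :
    ∀ᵐ ω ∂μ, Tendsto (fun n : ℕ => (H n ω : ℝ) / n) atTop (nhds (1 / 2)) := by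
  have hsucc : ∀ n ω, H (n + 1) ω = H n ω + X (n + 1) ω := fun n ω => by
    rw [hH, hH, Finset.sum_Icc_succ_top (by omega)]
  have hzero : ∀ ω, H 0 ω = 0 := fun ω => by simp [hH]
  have hHle : ∀ n ω, H n ω ≤ n := fun n ω => by
    induction n with
    | zero => simp [hzero]
    | succ n ih => have := hX01 (n + 1) ω; rw [hsucc]; omega
  have hX : ∀ n ω, (X n ω : ℝ) = 0 ∨ (X n ω : ℝ) = 1 := fun n ω => by
    have := hX01 n ω
    have : X n ω = 0 ∨ X n ω = 1 := by omega
    exact_mod_cast this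
  have hHmeas : ∀ n, Measurable[ℱ n] fun ω => (H n ω : ℝ) := fun n => by
    simp_rw [hH, Nat.cast_sum]
    exact Finset.measurable_fun_sum _ fun k hk =>
      (hadapted k).mono (ℱ.mono (Finset.mem_Icc.1 hk).2) le_rfl
  let Z : ℕ → Ω → ℝ := fun n ω => 2 * H n ω - n + (b - a)
  have hZmeas : ∀ n, Measurable[ℱ n] (Z n) := fun n =>
    (((hHmeas n).const_mul 2).sub_const (n : ℝ)).add_const (b - a)
  have hZbound : ∀ n ω, |Z n ω| ≤ n + |b - a| := fun n ω => by
    have h₁ : (H n ω : ℝ) ≤ n := by exact_mod_cast hHle n ω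
    have h₂ : (0 : ℝ) ≤ H n ω := by positivity
    refine (abs_add_le _ _).trans (add_le_add_left (abs_le.2 ⟨?_, ?_⟩) _) <;> linarith
  have hZsucc : ∀ n ω, Z (n + 1) ω = Z n ω + (2 * (X (n + 1) ω : ℝ) - 1) := fun n ω => by
    simp only [Z, hsucc]
    push_cast
    ring
  have hZsq : ∀ n, Integrable (fun ω => Z n ω ^ 2) μ := fun n => by
    refine Integrable.of_bound (((hZmeas n).mono (ℱ.le n) le_rfl).pow_const 2).aestronglyMeasurable
      ((n + |b - a|) ^ 2) (.of_forall fun ω => ?_)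
    rw [norm_pow, Real.norm_eq_abs]
    gcongr
    exact hZbound n ω
  have hmoment : ∀ n : ℕ, ∫ ω, Z n ω ^ 2 ∂μ ≤ (b - a) ^ 2 + n := fun n => by
    induction n with
    | zero => simp [Z, hzero]
    | succ n ih =>
      have hs : (0 : ℝ) < n + a + b := by positivity
      have hstep := integral_sq_add_le_of_condExp_eq (ℱ.le n) (hZmeas n) (hZbound n)
        ((hadapted (n + 1)).mono (ℱ.le _) le_rfl) (hX (n + 1)) hs
        ((hcond n).trans (.of_forall fun ω => by
          simp only [Z]
          field_simp
          ring))
      simp_rw [hZsucc]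
      push_cast
      linarith
  filter_upwards [ae_tendsto_div_sq_of_integral_sq_le hZsq hmoment] with ω hω
  have hlim := tendsto_div_nat_of_tendsto_div_sq (z := fun n => Z n ω) (fun n => by
    simp only [hZsucc]
    rcases hX (n + 1) ω with h | h <;> rw [h] <;> norm_num) hω
  have hlim' := ((hlim.sub (tendsto_const_div_atTop_nhds_zero_nat (b - a))).div_const 2).add_const
    (1 / 2 : ℝ)
  simp only [sub_zero, zero_div, zero_add] at hlim'
  refine hlim'.congr' ?_
  filter_upwards [eventually_ge_atTop 1] with n hn
  have hn' : (0 : ℝ) < n := by exact_mod_cast hn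
  simp only [Z]
  field_simp
  ring
end

section
/- Fix (h,n) ∈ ℕ×ℕ with h ≤ n and π ∈ [0,1]. Let (h_k), (n_k) be sequences of natural numbers with h_k ≤ n_k, n_k → ∞ and h_k/n_k → π. Then the ratio of binomial coefficients C(n_k − n, h_k − h)/C(n_k, h_k) converges to π^h (1−π)^{n−h} as k → ∞ (with the convention C(n_k−n, h_k−h) = 0 when h_k < h or n_k − n < h_k − h). -/
open Filter

/-- Truncated subtraction of a constant does not change the asymptotic ratio. -/
theorem tendsto_natCast_sub_div {a N : ℕ → ℕ} {x : ℝ} (hN : Tendsto N atTop atTop)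
    (ha : Tendsto (fun k => (a k : ℝ) / (N k : ℝ)) atTop (nhds x)) (j : ℕ) :
    Tendsto (fun k => ((a k - j : ℕ) : ℝ) / (N k : ℝ)) atTop (nhds x) := by
  have hj : Tendsto (fun k => (j : ℝ) / (N k : ℝ)) atTop (nhds 0) :=
    (tendsto_const_div_atTop_nhds_zero_nat (j : ℝ)).comp hN
  have hlow : Tendsto (fun k => (a k : ℝ) / (N k : ℝ) - (j : ℝ) / (N k : ℝ)) atTop (nhds x) := by
    simpa using ha.sub hj
  refine tendsto_of_tendsto_of_tendsto_of_le_of_le hlow ha (fun k => ?_) (fun k => ?_)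
  · have hk : (a k : ℝ) ≤ ((a k - j : ℕ) : ℝ) + j := by exact_mod_cast le_tsub_add
    simp only [← sub_div]
    gcongr
    linarith
  · dsimp only
    gcongr
    exact Nat.sub_le _ _

theorem tendsto_descFactorial_div_pow {a N : ℕ → ℕ} {x : ℝ} (hN : Tendsto N atTop atTop)
    (ha : Tendsto (fun k => (a k : ℝ) / (N k : ℝ)) atTop (nhds x)) (j : ℕ) :
    Tendsto (fun k => ((a k).descFactorial j : ℝ) / (N k : ℝ) ^ j) atTop (nhds (x ^ j)) := by
  induction j with
  | zero => simp
  | succ j ih =>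
    rw [pow_succ']
    refine ((tendsto_natCast_sub_div hN ha j).mul ih).congr fun k => ?_
    rw [Nat.descFactorial_succ, Nat.cast_mul, pow_succ', mul_div_mul_comm]

/-- The ratio of binomial coefficients as a ratio of falling factorials. -/
theorem choose_div_choose_eq_descFactorial (a b h m : ℕ) :
    ((a + b).choose a : ℝ) / ((h + a + (m + b)).choose (h + a) : ℝ) =
      ((h + a).descFactorial h : ℝ) * ((m + b).descFactorial m : ℝ) /
        ((h + a + (m + b)).descFactorial (h + m) : ℝ) := by
  have e1 := Nat.add_choose_mul_factorial_mul_factorial a b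
  have e2 := Nat.add_choose_mul_factorial_mul_factorial (h + a) (m + b)
  rw [← Nat.choose_symm_add] at e1 e2
  have e3 := Nat.factorial_mul_descFactorial (Nat.le_add_right h a)
  have e4 := Nat.factorial_mul_descFactorial (Nat.le_add_right m b)
  have e5 := Nat.factorial_mul_descFactorial (show h + m ≤ h + a + (m + b) by lia)
  rw [Nat.add_sub_cancel_left] at e3 e4
  rw [show h + a + (m + b) - (h + m) = a + b by lia] at e5
  have hc : ((h + a + (m + b)).choose (h + a) : ℝ) ≠ 0 :=
    Nat.cast_ne_zero.2 (Nat.choose_pos (Nat.le_add_right _ _)).ne'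
  have hd : ((h + a + (m + b)).descFactorial (h + m) : ℝ) ≠ 0 :=
    Nat.cast_ne_zero.2 (Nat.descFactorial_pos.2 (by lia)).ne'
  rw [div_eq_div_iff hc hd]
  norm_cast
  apply Nat.eq_of_mul_eq_mul_right (Nat.mul_pos a.factorial_pos b.factorial_pos)
  calc _ = ((a + b).choose a * a.factorial * b.factorial) *
        (h + a + (m + b)).descFactorial (h + m) := by ring
    _ = (h + a + (m + b)).choose (h + a) * (h + a).factorial * (m + b).factorial := by
      rw [e1, e5, e2]
    _ = _ := by rw [← e3, ← e4]; ring

/-- Martin kernel convergence for the Pascal triangle: if `h_k/n_k → π` and `n_k → ∞`, then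
`C(n_k - n, h_k - h)/C(n_k, h_k) → π^h (1-π)^{n-h}`, with the convention that the numerator is
zero when `h_k < h` or `n_k - n < h_k - h`. -/
theorem pascal_martin_kernel_convergence
    (h n : ℕ) (hhn : h ≤ n) (π : ℝ) (hπ : π ∈ Set.Icc (0 : ℝ) 1)
    (hk nk : ℕ → ℕ) (hle : ∀ k, hk k ≤ nk k)
    (hninf : Tendsto nk atTop atTop)
    (hratio : Tendsto (fun k => (hk k : ℝ) / (nk k : ℝ)) atTop (nhds π)) :
    Tendsto (fun k =>
        if h ≤ hk k ∧ ((hk k : ℤ) - h ≤ (nk k : ℤ) - n) then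
          ((nk k - n).choose (hk k - h) : ℝ) / ((nk k).choose (hk k) : ℝ)
        else 0)
      atTop (nhds (π ^ h * (1 - π) ^ (n - h))) := by
  have hpos : ∀ᶠ k in atTop, 0 < nk k := hninf.eventually_gt_atTop 0
  have hone : Tendsto (fun k => (nk k : ℝ) / (nk k : ℝ)) atTop (nhds 1) := by
    refine tendsto_const_nhds.congr' ?_
    filter_upwards [hpos] with k hk0
    rw [div_self (Nat.cast_ne_zero.2 hk0.ne')]
  have hcompl : Tendsto (fun k => ((nk k - hk k : ℕ) : ℝ) / (nk k : ℝ)) atTop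
      (nhds (1 - π)) := by
    refine (hone.sub hratio).congr fun k => ?_
    rw [Nat.cast_sub (hle k), sub_div]
  have hlim := ((tendsto_descFactorial_div_pow hninf hratio h).mul
    (tendsto_descFactorial_div_pow hninf hcompl (n - h))).div
    (tendsto_descFactorial_div_pow hninf hone n) (by simp)
  rw [one_pow, div_one] at hlim
  refine hlim.congr' ?_
  filter_upwards [hpos, hninf.eventually_ge_atTop n] with k hk0 hkn
  have hne : (nk k : ℝ) ^ n ≠ 0 := pow_ne_zero _ (Nat.cast_ne_zero.2 hk0.ne')
  have hsplit : (nk k : ℝ) ^ h * (nk k : ℝ) ^ (n - h) = (nk k : ℝ) ^ n := by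
    rw [← pow_add, Nat.add_sub_cancel' hhn]
  simp only [Pi.div_apply]
  rw [div_mul_div_comm, hsplit, div_div_div_cancel_right₀ hne]
  have hkle := hle k
  split_ifs with hcond
  · obtain ⟨a, ha⟩ := Nat.exists_eq_add_of_le hcond.1
    obtain ⟨b, hb⟩ := Nat.exists_eq_add_of_le (show n - h ≤ nk k - hk k by lia)
    have key := choose_div_choose_eq_descFactorial a b h (n - h)
    rw [← ha, ← hb, Nat.add_sub_cancel' hkle, Nat.add_sub_cancel' hhn] at key
    rw [← key, show nk k - n = a + b by lia, show hk k - h = a by lia]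
  · rcases lt_or_ge (hk k) h with hlt | hge
    · simp [Nat.descFactorial_of_lt hlt]
    · have hlt : nk k - hk k < n - h := by lia
      simp [Nat.descFactorial_of_lt hlt]
end
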